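/- Let n ≥ 0 and 0 ≤ k ≤ n, and consider BCT(k^n, k^n) where k^n = (k,...,k) ∈ ℕ^n. The combinatorial Bruhat order ≤_B and the combinatorial secondary Bruhat order ≤_{secB} coincide on BCT(k^n, k^n) if and only if either 0 ≤ n ≤ 5, or n ≥ 6 and k ∈ {0, 1, 2, n−2, n−1, n}. -/

import Mathlib

open Finset

/-- `M` is a 0-1 matrix with row sum vector `r` and column sum vector `c`. -/
def isBCT {m n : ℕ} (r : Fin m → ℕ) (c : Fin n → ℕ) (M : Fin m → Fin n → ℕ) : Prop :=
  (∀ i j, M i j = 0 ∨ M i j = 1) ∧ (∀ i, ∑ j, M i j = r i) ∧ (∀ j, ∑ i, M i j = c j)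

/-- `M'` is obtained from `M` by a single `L2 → I2` interchange. -/
def InterchangeStep {m n : ℕ} (M M' : Fin m → Fin n → ℕ) : Prop :=
  ∃ (i j : Fin m) (k l : Fin n), i < j ∧ k < l ∧
    M i k = 0 ∧ M i l = 1 ∧ M j k = 1 ∧ M j l = 0 ∧
    M' i k = 1 ∧ M' i l = 0 ∧ M' j k = 0 ∧ M' j l = 1 ∧
    (∀ p q, ¬((p = i ∨ p = j) ∧ (q = k ∨ q = l)) → M' p q = M p q)

/-- The combinatorial secondary Bruhat order: `M1 ≤ M2` iff `M1` is obtained from `M2`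
by a (possibly empty) finite sequence of `L2 → I2` interchanges. -/
def secBLE {m n : ℕ} (M1 M2 : Fin m → Fin n → ℕ) : Prop :=
  Relation.ReflTransGen InterchangeStep M2 M1

/-- `σ(M)_{ij} = ∑_{k ≤ i} ∑_{l ≤ j} m_{kl}`. -/
def sigmaM {m n : ℕ} (M : Fin m → Fin n → ℕ) (i : Fin m) (j : Fin n) : ℕ :=
  ∑ k ∈ Finset.univ.filter (fun k : Fin m => k ≤ i),
    ∑ l ∈ Finset.univ.filter (fun l : Fin n => l ≤ j), M k l

/-- The combinatorial Bruhat order: `M1 ≤_B M2` iff `σ(M1) ≥ σ(M2)` entrywise. -/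
def bruhatLE {m n : ℕ} (M1 M2 : Fin m → Fin n → ℕ) : Prop :=
  ∀ i j, sigmaM M2 i j ≤ sigmaM M1 i j


/-! ### Box sums -/

/-- The sum of the entries of `M` in the rows `y₀ ≤ r < y₁` and columns `q₀ ≤ s < q₁`. -/
def boxSum {m n : ℕ} (M : Fin m → Fin n → ℕ) (y₀ y₁ q₀ q₁ : ℕ) : ℕ :=
  ∑ r : Fin m, ∑ s : Fin n,
    if y₀ ≤ (r : ℕ) ∧ (r : ℕ) < y₁ ∧ q₀ ≤ (s : ℕ) ∧ (s : ℕ) < q₁ then M r s else 0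

/-- The matrix unit with its single `1` in position `(i, k)`. -/
def unitMatrix {m n : ℕ} (i : Fin m) (k : Fin n) : Fin m → Fin n → ℕ :=
  fun r s => if r = i ∧ s = k then 1 else 0

section Box

variable {m n : ℕ}

theorem boxSum_congr {M N : Fin m → Fin n → ℕ} {y₀ y₁ q₀ q₁ : ℕ}
    (h : ∀ (r : Fin m) (s : Fin n), y₀ ≤ (r : ℕ) → (r : ℕ) < y₁ → q₀ ≤ (s : ℕ) → (s : ℕ) < q₁ →
      M r s = N r s) :
    boxSum M y₀ y₁ q₀ q₁ = boxSum N y₀ y₁ q₀ q₁ := by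
  refine sum_congr rfl fun r _ => sum_congr rfl fun s _ => ?_
  split_ifs with hb
  · exact h r s hb.1 hb.2.1 hb.2.2.1 hb.2.2.2
  · rfl

theorem boxSum_mono {M N : Fin m → Fin n → ℕ} {y₀ y₁ q₀ q₁ : ℕ}
    (h : ∀ (r : Fin m) (s : Fin n), y₀ ≤ (r : ℕ) → (r : ℕ) < y₁ → q₀ ≤ (s : ℕ) → (s : ℕ) < q₁ →
      M r s ≤ N r s) :
    boxSum M y₀ y₁ q₀ q₁ ≤ boxSum N y₀ y₁ q₀ q₁ := by
  refine sum_le_sum fun r _ => sum_le_sum fun s _ => ?_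
  split_ifs with hb
  · exact h r s hb.1 hb.2.1 hb.2.2.1 hb.2.2.2
  · rfl

theorem boxSum_add (M N : Fin m → Fin n → ℕ) (y₀ y₁ q₀ q₁ : ℕ) :
    boxSum (fun r s => M r s + N r s) y₀ y₁ q₀ q₁
      = boxSum M y₀ y₁ q₀ q₁ + boxSum N y₀ y₁ q₀ q₁ := by
  simp only [boxSum, ← sum_add_distrib]
  refine sum_congr rfl fun r _ => sum_congr rfl fun s _ => ?_
  split_ifs <;> rfl

theorem boxSum_zero (y₀ y₁ q₀ q₁ : ℕ) :
    boxSum (fun (_ : Fin m) (_ : Fin n) => 0) y₀ y₁ q₀ q₁ = 0 := by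
  simp [boxSum]

theorem boxSum_eq_zero {M : Fin m → Fin n → ℕ} {y₀ y₁ q₀ q₁ : ℕ}
    (h : ∀ (r : Fin m) (s : Fin n), y₀ ≤ (r : ℕ) → (r : ℕ) < y₁ → q₀ ≤ (s : ℕ) → (s : ℕ) < q₁ →
      M r s = 0) :
    boxSum M y₀ y₁ q₀ q₁ = 0 :=
  (boxSum_congr h).trans (boxSum_zero _ _ _ _)

theorem boxSum_rows (M : Fin m → Fin n → ℕ) {y₀ y₁ y₂ : ℕ} (h₁ : y₀ ≤ y₁) (h₂ : y₁ ≤ y₂)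
    (q₀ q₁ : ℕ) :
    boxSum M y₀ y₂ q₀ q₁ = boxSum M y₀ y₁ q₀ q₁ + boxSum M y₁ y₂ q₀ q₁ := by
  simp only [boxSum, ← sum_add_distrib]
  refine sum_congr rfl fun r _ => sum_congr rfl fun s _ => ?_
  split_ifs <;> omega

theorem boxSum_cols (M : Fin m → Fin n → ℕ) (y₀ y₁ : ℕ) {q₀ q₁ q₂ : ℕ} (h₁ : q₀ ≤ q₁)
    (h₂ : q₁ ≤ q₂) :
    boxSum M y₀ y₁ q₀ q₂ = boxSum M y₀ y₁ q₀ q₁ + boxSum M y₀ y₁ q₁ q₂ := by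
  simp only [boxSum, ← sum_add_distrib]
  refine sum_congr rfl fun r _ => sum_congr rfl fun s _ => ?_
  split_ifs <;> omega

theorem boxSum_unitMatrix (i : Fin m) (k : Fin n) (y₀ y₁ q₀ q₁ : ℕ) :
    boxSum (unitMatrix i k) y₀ y₁ q₀ q₁
      = if y₀ ≤ (i : ℕ) ∧ (i : ℕ) < y₁ ∧ q₀ ≤ (k : ℕ) ∧ (k : ℕ) < q₁ then 1 else 0 := by
  unfold boxSum
  rw [sum_eq_single i, sum_eq_single k]
  · simp [unitMatrix]
  · intro s _ hs
    simp [unitMatrix, hs]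
  · simp
  · intro r _ hr
    simp [unitMatrix, hr]
  · simp

theorem one_le_boxSum {M : Fin m → Fin n → ℕ} {y₀ y₁ q₀ q₁ : ℕ} {r : Fin m} {s : Fin n}
    (h : M r s = 1) (h₁ : y₀ ≤ (r : ℕ)) (h₂ : (r : ℕ) < y₁) (h₃ : q₀ ≤ (s : ℕ))
    (h₄ : (s : ℕ) < q₁) : 1 ≤ boxSum M y₀ y₁ q₀ q₁ := by
  calc 1 = boxSum (unitMatrix r s) y₀ y₁ q₀ q₁ := by
        rw [boxSum_unitMatrix, if_pos ⟨h₁, h₂, h₃, h₄⟩]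
    _ ≤ _ := boxSum_mono fun r' s' _ _ _ _ => by
        unfold unitMatrix
        split_ifs with he
        · rw [he.1, he.2, h]
        · exact Nat.zero_le _

theorem boxSum_le_one {M : Fin m → Fin n → ℕ} (h01 : ∀ i j, M i j = 0 ∨ M i j = 1)
    {y₀ y₁ q₀ q₁ : ℕ} {r₀ : Fin m} {s₀ : Fin n}
    (h : ∀ (r : Fin m) (s : Fin n), y₀ ≤ (r : ℕ) → (r : ℕ) < y₁ → q₀ ≤ (s : ℕ) → (s : ℕ) < q₁ →
      M r s = 1 → r = r₀ ∧ s = s₀) :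
    boxSum M y₀ y₁ q₀ q₁ ≤ 1 := by
  calc boxSum M y₀ y₁ q₀ q₁ ≤ boxSum (unitMatrix r₀ s₀) y₀ y₁ q₀ q₁ :=
        boxSum_mono fun r s h₁ h₂ h₃ h₄ => by
          rcases h01 r s with h0 | h1
          · omega
          · obtain ⟨rfl, rfl⟩ := h r s h₁ h₂ h₃ h₄ h1
            simp [unitMatrix, h1]
    _ ≤ 1 := by
        rw [boxSum_unitMatrix]
        split_ifs <;> omega

theorem boxSum_all_rows {M : Fin m → Fin n → ℕ} {c : Fin n → ℕ} (hc : ∀ j, ∑ i, M i j = c j)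
    (q₀ q₁ : ℕ) :
    boxSum M 0 m q₀ q₁ = ∑ s : Fin n, if q₀ ≤ (s : ℕ) ∧ (s : ℕ) < q₁ then c s else 0 := by
  unfold boxSum
  rw [sum_comm]
  refine sum_congr rfl fun s _ => ?_
  split_ifs with h
  · simp [h, hc]
  · exact sum_eq_zero fun r _ => if_neg fun hb => h hb.2.2

theorem boxSum_all_cols {M : Fin m → Fin n → ℕ} {r : Fin m → ℕ} (hr : ∀ i, ∑ j, M i j = r i)
    (y₀ y₁ : ℕ) :
    boxSum M y₀ y₁ 0 n = ∑ i : Fin m, if y₀ ≤ (i : ℕ) ∧ (i : ℕ) < y₁ then r i else 0 := by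
  unfold boxSum
  refine sum_congr rfl fun i _ => ?_
  split_ifs with h
  · simp [h, hr]
  · exact sum_eq_zero fun s _ => if_neg fun hb => h ⟨hb.1, hb.2.1⟩

theorem sigmaM_eq_boxSum (M : Fin m → Fin n → ℕ) (i : Fin m) (j : Fin n) :
    sigmaM M i j = boxSum M 0 (i + 1) 0 (j + 1) := by
  unfold sigmaM boxSum
  rw [sum_filter]
  refine sum_congr rfl fun r _ => ?_
  split_ifs with h
  · rw [sum_filter]
    refine sum_congr rfl fun s _ => ?_
    simp only [Fin.le_def] at h ⊢
    exact if_congr (by omega) rfl rfl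
  · refine (sum_eq_zero fun s _ => if_neg ?_).symm
    simp only [Fin.le_def] at h
    omega

theorem boxSum_min (M : Fin m → Fin n → ℕ) (y q : ℕ) :
    boxSum M 0 y 0 q = boxSum M 0 (min y m) 0 (min q n) := by
  refine sum_congr rfl fun r _ => sum_congr rfl fun s _ => if_congr ?_ rfl rfl
  omega

theorem bruhatLE_iff_boxSum {A C : Fin m → Fin n → ℕ} :
    bruhatLE A C ↔ ∀ y q, boxSum C 0 y 0 q ≤ boxSum A 0 y 0 q := by
  constructor
  · intro h y q
    rw [boxSum_min C, boxSum_min A]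
    obtain hy | hy := Nat.eq_zero_or_pos (min y m)
    · rw [hy, boxSum_eq_zero fun r s _ h _ _ => absurd h (Nat.not_lt_zero _)]
      exact Nat.zero_le _
    obtain hq | hq := Nat.eq_zero_or_pos (min q n)
    · rw [hq, boxSum_eq_zero fun r s _ _ _ h => absurd h (Nat.not_lt_zero _)]
      exact Nat.zero_le _
    have h' := h ⟨min y m - 1, by omega⟩ ⟨min q n - 1, by omega⟩
    simp only [sigmaM_eq_boxSum] at h'
    rwa [Nat.sub_add_cancel hy, Nat.sub_add_cancel hq] at h'
  · intro h i j
    rw [sigmaM_eq_boxSum, sigmaM_eq_boxSum]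
    exact h _ _

theorem eq_of_boxSum_eq {A C : Fin m → Fin n → ℕ}
    (h : ∀ y q, boxSum C 0 y 0 q = boxSum A 0 y 0 q) : A = C := by
  have key : ∀ M : Fin m → Fin n → ℕ, ∀ (i : Fin m) (j : Fin n),
      boxSum M 0 (i + 1) 0 (j + 1) + boxSum M 0 i 0 j
        = boxSum M 0 (i + 1) 0 j + boxSum M 0 i 0 (j + 1) + M i j := by
    intro M i j
    have h1 := boxSum_cols M 0 (i + 1) (Nat.zero_le j) (Nat.le_succ j)
    have h2 := boxSum_cols M 0 i (Nat.zero_le j) (Nat.le_succ j)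
    have h3 := boxSum_rows M (Nat.zero_le i) (Nat.le_succ i) j (j + 1)
    have h4 : boxSum M i (i + 1) j (j + 1) = M i j := by
      unfold boxSum
      rw [sum_eq_single i, sum_eq_single j]
      · simp
      · intro s _ hs
        exact if_neg fun hb => hs (Fin.ext (by omega))
      · simp
      · intro r _ hr
        exact sum_eq_zero fun s _ => if_neg fun hb => hr (Fin.ext (by omega))
      · simp
    simp only [Nat.succ_eq_add_one] at *
    omega
  funext i j
  have hA := key A i j
  have hC := key C i j
  simp only [h] at hC
  omega

end Box

/-! ### Interchanges -/

section Interchange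

variable {m n : ℕ}

theorem InterchangeStep.add_unitMatrix {M M' : Fin m → Fin n → ℕ} {i j : Fin m} {k l : Fin n}
    (hij : i < j) (hkl : k < l)
    (h₁ : M i k = 0) (h₂ : M i l = 1) (h₃ : M j k = 1) (h₄ : M j l = 0)
    (h₁' : M' i k = 1) (h₂' : M' i l = 0) (h₃' : M' j k = 0) (h₄' : M' j l = 1)
    (h : ∀ p q, ¬((p = i ∨ p = j) ∧ (q = k ∨ q = l)) → M' p q = M p q) (r : Fin m) (s : Fin n) :
    M' r s + unitMatrix i l r s + unitMatrix j k r s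
      = M r s + unitMatrix i k r s + unitMatrix j l r s := by
  by_cases hr : (r = i ∨ r = j) ∧ (s = k ∨ s = l)
  · obtain ⟨rfl | rfl, rfl | rfl⟩ := hr <;>
      simp [unitMatrix, hij.ne, hij.ne', hkl.ne, hkl.ne', *]
  · rw [h r s hr]
    have h1 : unitMatrix i l r s = 0 := if_neg (by tauto)
    have h2 : unitMatrix j k r s = 0 := if_neg (by tauto)
    have h3 : unitMatrix i k r s = 0 := if_neg (by tauto)
    have h4 : unitMatrix j l r s = 0 := if_neg (by tauto)
    rw [h1, h2, h3, h4]

theorem boxSum_of_add_unitMatrix {M M' : Fin m → Fin n → ℕ} {i j : Fin m} {k l : Fin n}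
    (hij : i < j) (hkl : k < l)
    (h : ∀ r s, M' r s + unitMatrix i l r s + unitMatrix j k r s
      = M r s + unitMatrix i k r s + unitMatrix j l r s) (y q : ℕ) :
    boxSum M' 0 y 0 q = boxSum M 0 y 0 q
      + if (i : ℕ) < y ∧ y ≤ j ∧ (k : ℕ) < q ∧ q ≤ l then 1 else 0 := by
  have h' := congrArg (fun N => boxSum N 0 y 0 q) (funext fun r => funext fun s => h r s)
  simp only [boxSum_add, boxSum_unitMatrix] at h'
  rw [Fin.lt_def] at hij hkl
  split_ifs at h' ⊢ <;> omega

theorem isBCT_of_interchangeStep {r : Fin m → ℕ} {c : Fin n → ℕ} {M M' : Fin m → Fin n → ℕ}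
    (hM : isBCT r c M) (h : InterchangeStep M M') : isBCT r c M' := by
  obtain ⟨i, j, k, l, hij, hkl, h₁, h₂, h₃, h₄, h₁', h₂', h₃', h₄', hrest⟩ := h
  have key := InterchangeStep.add_unitMatrix hij hkl h₁ h₂ h₃ h₄ h₁' h₂' h₃' h₄' hrest
  have hrow : ∀ (a : Fin m) (b : Fin n) (p : Fin m),
      ∑ q, unitMatrix a b p q = if p = a then 1 else 0 := by
    intro a b p
    simp only [unitMatrix]
    split_ifs with hp <;> simp [hp]
  have hcol : ∀ (a : Fin m) (b : Fin n) (q : Fin n),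
      ∑ p, unitMatrix a b p q = if q = b then 1 else 0 := by
    intro a b q
    simp only [unitMatrix]
    split_ifs with hq <;> simp [hq]
  refine ⟨fun p q => ?_, fun p => ?_, fun q => ?_⟩
  · by_cases hpq : (p = i ∨ p = j) ∧ (q = k ∨ q = l)
    · obtain ⟨rfl | rfl, rfl | rfl⟩ := hpq <;> simp [*]
    · rw [hrest p q hpq]
      exact hM.1 p q
  · have hs := sum_congr (rfl : (univ : Finset (Fin n)) = univ) fun q _ => key p q
    simp only [sum_add_distrib, hrow] at hs
    rw [← hM.2.1 p]
    omega
  · have hs := sum_congr (rfl : (univ : Finset (Fin m)) = univ) fun p _ => key p q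
    simp only [sum_add_distrib, hcol] at hs
    rw [← hM.2.2 q]
    omega

theorem InterchangeStep.bruhatLE {M M' : Fin m → Fin n → ℕ} (h : InterchangeStep M M') :
    bruhatLE M' M := by
  obtain ⟨i, j, k, l, hij, hkl, h₁, h₂, h₃, h₄, h₁', h₂', h₃', h₄', hrest⟩ := h
  rw [bruhatLE_iff_boxSum]
  intro y q
  rw [boxSum_of_add_unitMatrix hij hkl
    (InterchangeStep.add_unitMatrix hij hkl h₁ h₂ h₃ h₄ h₁' h₂' h₃' h₄' hrest)]
  exact Nat.le_add_right _ _

theorem InterchangeStep.ne {M M' : Fin m → Fin n → ℕ} (h : InterchangeStep M M') : M' ≠ M := by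
  rintro rfl
  obtain ⟨i, j, k, l, -, -, h₁, -, -, -, h₁', -⟩ := h
  omega

theorem bruhatLE_of_secBLE {A C : Fin m → Fin n → ℕ} (h : secBLE A C) : bruhatLE A C := by
  unfold secBLE at h
  induction h with
  | refl => exact fun _ _ => le_rfl
  | tail _ hstep ih => exact fun i j => (ih i j).trans (hstep.bruhatLE i j)

/-- Some interchange on `C` keeps it above `A` in the Bruhat order. -/
def HasInterchangeAbove (A C : Fin m → Fin n → ℕ) : Prop :=
  ∃ (i j : Fin m) (k l : Fin n), i < j ∧ k < l ∧
    C i k = 0 ∧ C i l = 1 ∧ C j k = 1 ∧ C j l = 0 ∧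
    ∀ y q : ℕ, (i : ℕ) < y → y ≤ j → (k : ℕ) < q → q ≤ l → boxSum C 0 y 0 q < boxSum A 0 y 0 q

theorem exists_interchangeStep {C : Fin m → Fin n → ℕ} {i j : Fin m} {k l : Fin n}
    (hij : i < j) (hkl : k < l)
    (h₁ : C i k = 0) (h₂ : C i l = 1) (h₃ : C j k = 1) (h₄ : C j l = 0) :
    ∃ C', InterchangeStep C C' ∧
      (∀ r s, C' r s = if r = i ∧ s = k ∨ r = j ∧ s = l then 1
        else if r = i ∧ s = l ∨ r = j ∧ s = k then 0 else C r s) ∧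
      ∀ y q : ℕ, boxSum C' 0 y 0 q = boxSum C 0 y 0 q
        + if (i : ℕ) < y ∧ y ≤ j ∧ (k : ℕ) < q ∧ q ≤ l then 1 else 0 := by
  let C' : Fin m → Fin n → ℕ := fun r s =>
    if r = i ∧ s = k ∨ r = j ∧ s = l then 1
    else if r = i ∧ s = l ∨ r = j ∧ s = k then 0 else C r s
  have h₁' : C' i k = 1 := by simp [C']
  have h₂' : C' i l = 0 := by simp [C', hij.ne, hkl.ne']
  have h₃' : C' j k = 0 := by simp [C', hij.ne', hkl.ne]
  have h₄' : C' j l = 1 := by simp [C']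
  have hrest : ∀ r s, ¬((r = i ∨ r = j) ∧ (s = k ∨ s = l)) → C' r s = C r s := by
    intro r s hrs
    simp only [C']
    rw [if_neg (by tauto), if_neg (by tauto)]
  exact ⟨C', ⟨i, j, k, l, hij, hkl, h₁, h₂, h₃, h₄, h₁', h₂', h₃', h₄', hrest⟩, fun _ _ => rfl,
    boxSum_of_add_unitMatrix hij hkl
      (InterchangeStep.add_unitMatrix hij hkl h₁ h₂ h₃ h₄ h₁' h₂' h₃' h₄' hrest)⟩

theorem exists_interchangeStep_to {B : Fin m → Fin n → ℕ} {i j : Fin m} {k l : Fin n}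
    (hij : i < j) (hkl : k < l)
    (h₁ : B i k = 1) (h₂ : B i l = 0) (h₃ : B j k = 0) (h₄ : B j l = 1) :
    ∃ A, InterchangeStep A B ∧ ∀ y q : ℕ, boxSum B 0 y 0 q = boxSum A 0 y 0 q
        + if (i : ℕ) < y ∧ y ≤ j ∧ (k : ℕ) < q ∧ q ≤ l then 1 else 0 := by
  let A : Fin m → Fin n → ℕ := fun r s =>
    if r = i ∧ s = k ∨ r = j ∧ s = l then 0
    else if r = i ∧ s = l ∨ r = j ∧ s = k then 1 else B r s
  have h₁' : A i k = 0 := by simp [A]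
  have h₂' : A i l = 1 := by simp [A, hij.ne, hkl.ne']
  have h₃' : A j k = 1 := by simp [A, hij.ne', hkl.ne]
  have h₄' : A j l = 0 := by simp [A]
  have hrest : ∀ r s, ¬((r = i ∨ r = j) ∧ (s = k ∨ s = l)) → B r s = A r s := by
    intro r s hrs
    simp only [A]
    rw [if_neg (by tauto), if_neg (by tauto)]
  exact ⟨A, ⟨i, j, k, l, hij, hkl, h₁', h₂', h₃', h₄', h₁, h₂, h₃, h₄, hrest⟩,
    boxSum_of_add_unitMatrix hij hkl
      (InterchangeStep.add_unitMatrix hij hkl h₁' h₂' h₃' h₄' h₁ h₂ h₃ h₄ hrest)⟩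

theorem HasInterchangeAbove.exists_step {A C : Fin m → Fin n → ℕ} (hAC : bruhatLE A C)
    (h : HasInterchangeAbove A C) : ∃ C', InterchangeStep C C' ∧ bruhatLE A C' := by
  obtain ⟨i, j, k, l, hij, hkl, h₁, h₂, h₃, h₄, hlt⟩ := h
  obtain ⟨C', hstep, -, hbox⟩ := exists_interchangeStep hij hkl h₁ h₂ h₃ h₄
  refine ⟨C', hstep, ?_⟩
  rw [bruhatLE_iff_boxSum] at hAC ⊢
  intro y q
  rw [hbox]
  split_ifs with hb
  · exact hlt y q hb.1 hb.2.1 hb.2.2.1 hb.2.2.2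
  · exact hAC y q

end Interchange

/-! ### Reversing the columns and complementing -/

section Symmetry

variable {m n : ℕ}

/-- The matrix `M` with its columns in reverse order. -/
def colRev (M : Fin m → Fin n → ℕ) : Fin m → Fin n → ℕ := fun r s => M r s.rev

/-- The complement of a 0-1 matrix. -/
def complMatrix (M : Fin m → Fin n → ℕ) : Fin m → Fin n → ℕ := fun r s => 1 - M r s

theorem colRev_colRev (M : Fin m → Fin n → ℕ) : colRev (colRev M) = M := by
  funext r s
  simp [colRev]

theorem isBCT_colRev {r : Fin m → ℕ} {c : Fin n → ℕ} {M : Fin m → Fin n → ℕ}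
    (h : isBCT r c M) : isBCT r (fun j => c j.rev) (colRev M) :=
  ⟨fun i j => h.1 i j.rev,
    fun i => (Equiv.sum_comp Fin.revPerm (fun j => M i j)).trans (h.2.1 i),
    fun j => h.2.2 j.rev⟩

theorem boxSum_colRev (M : Fin m → Fin n → ℕ) (y q : ℕ) (hq : q ≤ n) :
    boxSum (colRev M) 0 y 0 q = boxSum M 0 y (n - q) n := by
  refine sum_congr rfl fun r _ => ?_
  rw [← Equiv.sum_comp Fin.revPerm]
  refine sum_congr rfl fun s _ => ?_
  simp only [Fin.revPerm_apply, colRev, Fin.rev_rev, Fin.val_rev]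
  exact if_congr (by omega) rfl rfl

theorem bruhatLE_colRev {r : Fin m → ℕ} {c : Fin n → ℕ} {A C : Fin m → Fin n → ℕ}
    (hA : isBCT r c A) (hC : isBCT r c C) (h : bruhatLE A C) :
    bruhatLE (colRev C) (colRev A) := by
  rw [bruhatLE_iff_boxSum] at h ⊢
  intro y q
  rw [boxSum_min (colRev A), boxSum_min (colRev C), boxSum_colRev _ _ _ (min_le_right _ _),
    boxSum_colRev _ _ _ (min_le_right _ _)]
  have h1 := boxSum_cols A 0 (min y m) (Nat.zero_le (n - min q n)) (Nat.sub_le _ _)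
  have h2 := boxSum_cols C 0 (min y m) (Nat.zero_le (n - min q n)) (Nat.sub_le _ _)
  rw [boxSum_all_cols hA.2.1] at h1
  rw [boxSum_all_cols hC.2.1] at h2
  have h3 := h (min y m) (n - min q n)
  omega

theorem interchangeStep_colRev {M M' : Fin m → Fin n → ℕ} (h : InterchangeStep M M') :
    InterchangeStep (colRev M') (colRev M) := by
  obtain ⟨i, j, k, l, hij, hkl, h₁, h₂, h₃, h₄, h₁', h₂', h₃', h₄', hrest⟩ := h
  refine ⟨i, j, l.rev, k.rev, hij, Fin.rev_lt_rev.mpr hkl, ?_⟩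
  simp only [colRev, Fin.rev_rev]
  refine ⟨h₂', h₁', h₄', h₃', h₂, h₁, h₄, h₃, fun p q hpq => (hrest p q.rev ?_).symm⟩
  rw [Fin.rev_eq_iff, Fin.rev_eq_iff]
  tauto

theorem isBCT_of_interchangeStep_to {r : Fin m → ℕ} {c : Fin n → ℕ} {M M' : Fin m → Fin n → ℕ}
    (hM : isBCT r c M') (h : InterchangeStep M M') : isBCT r c M := by
  have h' := isBCT_colRev (isBCT_of_interchangeStep (isBCT_colRev hM) (interchangeStep_colRev h))
  simpa only [colRev_colRev, Fin.rev_rev] using h'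

theorem complMatrix_complMatrix {M : Fin m → Fin n → ℕ} (h : ∀ i j, M i j = 0 ∨ M i j = 1) :
    complMatrix (complMatrix M) = M := by
  funext i j
  rcases h i j with h | h <;> simp [complMatrix, h]

theorem complMatrix_add {M : Fin m → Fin n → ℕ} (h : ∀ i j, M i j = 0 ∨ M i j = 1)
    (i : Fin m) (j : Fin n) : complMatrix M i j + M i j = 1 := by
  rcases h i j with h | h <;> simp [complMatrix, h]

theorem isBCT_complMatrix {r : Fin m → ℕ} {c : Fin n → ℕ} {M : Fin m → Fin n → ℕ}
    (h : isBCT r c M) : isBCT (fun i => n - r i) (fun j => m - c j) (complMatrix M) := by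
  refine ⟨fun i j => ?_, fun i => ?_, fun j => ?_⟩
  · rcases h.1 i j with h | h <;> simp [complMatrix, h]
  · have hs := sum_congr (rfl : (univ : Finset (Fin n)) = univ) fun j _ =>
      complMatrix_add h.1 i j
    rw [sum_add_distrib, h.2.1 i] at hs
    simp only [sum_const, card_univ, Fintype.card_fin, smul_eq_mul, mul_one] at hs
    exact Nat.eq_sub_of_add_eq hs
  · have hs := sum_congr (rfl : (univ : Finset (Fin m)) = univ) fun i _ =>
      complMatrix_add h.1 i j
    rw [sum_add_distrib, h.2.2 j] at hs
    simp only [sum_const, card_univ, Fintype.card_fin, smul_eq_mul, mul_one] at hs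
    exact Nat.eq_sub_of_add_eq hs

theorem bruhatLE_complMatrix {A C : Fin m → Fin n → ℕ} (hA : ∀ i j, A i j = 0 ∨ A i j = 1)
    (hC : ∀ i j, C i j = 0 ∨ C i j = 1) (h : bruhatLE A C) :
    bruhatLE (complMatrix C) (complMatrix A) := by
  rw [bruhatLE_iff_boxSum] at h ⊢
  intro y q
  have key : ∀ M : Fin m → Fin n → ℕ, (∀ i j, M i j = 0 ∨ M i j = 1) →
      boxSum (complMatrix M) 0 y 0 q + boxSum M 0 y 0 q
        = boxSum (fun (_ : Fin m) (_ : Fin n) => 1) 0 y 0 q := by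
    intro M hM
    rw [← boxSum_add]
    exact boxSum_congr fun r s _ _ _ _ => complMatrix_add hM r s
  have h1 := key A hA
  have h2 := key C hC
  have h3 := h y q
  omega

theorem interchangeStep_complMatrix {M M' : Fin m → Fin n → ℕ} (h : InterchangeStep M M') :
    InterchangeStep (complMatrix M') (complMatrix M) := by
  obtain ⟨i, j, k, l, hij, hkl, h₁, h₂, h₃, h₄, h₁', h₂', h₃', h₄', hrest⟩ := h
  refine ⟨i, j, k, l, hij, hkl, ?_⟩
  refine ⟨?_, ?_, ?_, ?_, ?_, ?_, ?_, ?_, fun p q hpq => ?_⟩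
  all_goals simp only [complMatrix]
  all_goals first | omega | rw [hrest p q hpq]

theorem secBLE_complMatrix {A C : Fin m → Fin n → ℕ} (h : secBLE A C) :
    secBLE (complMatrix C) (complMatrix A) := by
  unfold secBLE at *
  induction h with
  | refl => exact .refl
  | tail _ hstep ih => exact .head (interchangeStep_complMatrix hstep) ih

end Symmetry

/-! ### Line sums at most two -/

section LineSums

variable {m n : ℕ}

/-- A vector with sum at most two has at most two nonzero entries. -/
theorem eq_zero_of_sum_le_two {ι : Type*} [Fintype ι] {f : ι → ℕ}
    (hsum : ∑ i, f i ≤ 2) {x y z : ι} (hx : f x = 1) (hy : f y = 1) (hxy : x ≠ y)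
    (hzx : z ≠ x) (hzy : z ≠ y) : f z = 0 := by
  classical
  have h : ∑ i ∈ ({z, x, y} : Finset ι), f i ≤ 2 :=
    (sum_le_univ_sum_of_nonneg fun i => Nat.zero_le _).trans hsum
  rw [sum_insert (by simp [hzx, hzy]), sum_insert (by simp [hxy]), sum_singleton] at h
  omega

/-- In row `i`, the columns `a < c` witness the first difference between `A` and `C`: the rows
above agree, `A` has a one at `a`, `C` has a one at `c`, and the rows agree in between. -/
structure IsPivot (A C : Fin m → Fin n → ℕ) (i : Fin m) (a c : Fin n) : Prop where
  above : ∀ r < i, ∀ s, A r s = C r s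
  lt : a < c
  left_A : A i a = 1
  left_C : C i a = 0
  right_A : A i c = 0
  right_C : C i c = 1
  between : ∀ s, a < s → s < c → A i s = C i s

variable {A C : Fin m → Fin n → ℕ} {i : Fin m} {a c : Fin n}

theorem IsPivot.boxSum_lt (hP : IsPivot A C i a c) (hAC : bruhatLE A C) {y q : ℕ}
    (hy : (i : ℕ) < y) (haq : (a : ℕ) < q) (hqc : q ≤ c)
    (hbox : boxSum C (i + 1) y a q ≤ boxSum A (i + 1) y a q) :
    boxSum C 0 y 0 q < boxSum A 0 y 0 q := by
  rw [bruhatLE_iff_boxSum] at hAC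
  have h0 := hAC y a
  have hA1 := boxSum_cols A 0 y (Nat.zero_le a) haq.le
  have hC1 := boxSum_cols C 0 y (Nat.zero_le a) haq.le
  have hA2 := boxSum_rows A (Nat.zero_le (i + 1)) hy a q
  have hC2 := boxSum_rows C (Nat.zero_le (i + 1)) hy a q
  have hunit : boxSum (unitMatrix i a) 0 (i + 1) a q = 1 := by
    rw [boxSum_unitMatrix, if_pos (by omega)]
  have htop : boxSum A 0 (i + 1) a q
      = boxSum C 0 (i + 1) a q + boxSum (unitMatrix i a) 0 (i + 1) a q := by
    rw [← boxSum_add]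
    refine boxSum_congr fun r s _ hr has hsq => ?_
    unfold unitMatrix
    rcases (show r ≤ i from Nat.lt_succ_iff.mp hr).lt_or_eq with hlt | rfl
    · rw [if_neg fun h => hlt.ne h.1, hP.above r hlt, add_zero]
    · rcases (show a ≤ s from has).lt_or_eq with hlt | rfl
      · rw [if_neg fun h => hlt.ne' h.2, hP.between s hlt (hsq.trans_le hqc), add_zero]
      · simp [hP.left_A, hP.left_C]
  omega

theorem IsPivot.boxSum_lt_of_zero (hP : IsPivot A C i a c) (hAC : bruhatLE A C) {y q : ℕ}
    (hy : (i : ℕ) < y) (haq : (a : ℕ) < q) (hqc : q ≤ c)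
    (hzero : ∀ r s, i < r → (r : ℕ) < y → a ≤ s → (s : ℕ) < q → C r s = 0) :
    boxSum C 0 y 0 q < boxSum A 0 y 0 q := by
  refine hP.boxSum_lt hAC hy haq hqc ?_
  rw [boxSum_eq_zero fun r s h₁ h₂ h₃ h₄ => hzero r s h₁ h₂ h₃ h₄]
  exact Nat.zero_le _

/-- From a one of `C` at `(j, p)` with nothing to its lower left so far, pass to the next row
with a one in the columns `[a, p)`: either it can be used for an interchange with row `j`, or it
is blocked. -/
theorem IsPivot.exists_next {r : Fin m → ℕ} {d : Fin n → ℕ} (hP : IsPivot A C i a c)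
    (hA : isBCT r d A) (hC : isBCT r d C) (hAC : bruhatLE A C) {j : Fin m} {p : Fin n}
    (hij : i ≤ j) (hap : a < p) (hpc : p ≤ c) (hjp : C j p = 1)
    (hzero : ∀ r s, i < r → r ≤ j → a ≤ s → s < p → C r s = 0) :
    ∃ j' p', j < j' ∧ a ≤ p' ∧ p' < p ∧ C j' p' = 1 ∧
      (∀ r s, i < r → r < j' → a ≤ s → s < p → C r s = 0) ∧
      (C j p' = 1 ∨ C j' p = 1 ∨ HasInterchangeAbove A C) := by
  have hne : ∃ j' : Fin m, i < j' ∧ ∃ p', a ≤ p' ∧ p' < p ∧ C j' p' = 1 := by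
    by_contra! hcon
    have hlt := hP.boxSum_lt_of_zero hAC i.isLt hap hpc fun r s hr _ has hsp =>
      (hC.1 r s).resolve_right (hcon r hr s has hsp)
    rw [boxSum_all_rows hA.2.2, boxSum_all_rows hC.2.2] at hlt
    exact hlt.false
  obtain ⟨j', ⟨hij', p', hap', hp'p, hj'p'⟩, hmin⟩ := WellFounded.has_min wellFounded_lt
    {j' : Fin m | i < j' ∧ ∃ p', a ≤ p' ∧ p' < p ∧ C j' p' = 1} hne
  have hbefore : ∀ r s, i < r → r < j' → a ≤ s → s < p → C r s = 0 := fun r s hir hrj' has hsp =>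
    (hC.1 r s).resolve_right fun h1 => hmin r ⟨hir, s, has, hsp, h1⟩ hrj'
  have hjj' : j < j' := by
    by_contra hcon
    have := hzero j' p' hij' (not_lt.mp hcon) hap' hp'p
    omega
  refine ⟨j', p', hjj', hap', hp'p, hj'p', hbefore, ?_⟩
  rcases hC.1 j p' with hjp' | hjp'
  · rcases hC.1 j' p with hj'p | hj'p
    · refine Or.inr (Or.inr ⟨j, j', p', p, hjj', hp'p, hjp', hjp, hj'p', hj'p, ?_⟩)
      intro y q hy₁ hy₂ hq₁ hq₂
      simp only [Fin.le_def, Fin.lt_def] at *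
      refine hP.boxSum_lt_of_zero hAC (by omega) (by omega) (by omega) fun r s h₁ h₂ h₃ h₄ => ?_
      exact hbefore r s h₁ (by omega) h₃ (by omega)
    · exact Or.inr (Or.inl hj'p)
  · exact Or.inl hjp'

/-- If the rows of `A` and `C` both vanish strictly between the columns of the pivot, then `C` has
an interchange above `A`, unless `C` has a one in column `c` above all the further ones of `A` in
column `a`. -/
theorem IsPivot.hasInterchangeAbove_or {r : Fin m → ℕ} {d : Fin n → ℕ} (hP : IsPivot A C i a c)
    (hA : isBCT r d A) (hC : isBCT r d C) (hAC : bruhatLE A C) (hr : ∀ i, r i ≤ 2)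
    (hd : ∀ j, d j ≤ 2) (hrow : ∀ s, a < s → s < c → C i s = 0) :
    HasInterchangeAbove A C ∨ ∃ j₁, i < j₁ ∧ C j₁ c = 1 ∧ ∀ l, i < l → A l a = 1 → j₁ < l := by
  have row_eq_zero : ∀ (j : Fin m) {x y z : Fin n}, C j x = 1 → C j y = 1 → x ≠ y →
      z ≠ x → z ≠ y → C j z = 0 := fun j _ _ _ =>
    eq_zero_of_sum_le_two ((hC.2.1 j).le.trans (hr j))
  have col_eq_zero : ∀ (s : Fin n) {x y z : Fin m}, C x s = 1 → C y s = 1 → x ≠ y →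
      z ≠ x → z ≠ y → C z s = 0 := fun s _ _ _ =>
    eq_zero_of_sum_le_two (f := fun x => C x s) ((hC.2.2 s).le.trans (hd s))
  have stair : ∀ (p : Fin n) (j : Fin m), i ≤ j → a < p → p ≤ c → C j p = 1 →
      (∀ s, a ≤ s → s < p → C j s = 0) →
      (∀ r s, i < r → r ≤ j → a ≤ s → s < p → C r s = 0) →
      (p = c ∨ ∃ j₁, i < j₁ ∧ j₁ ≤ j ∧ C j₁ c = 1) →
      HasInterchangeAbove A C ∨
        ∃ j₁, i < j₁ ∧ C j₁ c = 1 ∧ ∀ l, i < l → A l a = 1 → j₁ < l := by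
    intro p
    induction p using WellFoundedLT.induction with
    | ind p ih =>
    intro j hij hap hpc hjp hj0 hzero hfirst
    obtain ⟨j', p', hjj', hap', hp'p, hj'p', hbefore, hcase⟩ :=
      hP.exists_next hA hC hAC hij hap hpc hjp hzero
    rcases hcase with h | hj'p | h
    · rw [hj0 p' hap' hp'p] at h
      exact absurd h (by norm_num)
    swap
    · exact Or.inl h
    have hj'0 : ∀ s, s ≠ p' → s < p → C j' s = 0 := fun s hs hsp =>
      row_eq_zero j' hj'p' hj'p hp'p.ne hs hsp.ne
    have hfirst' : ∃ j₁, i < j₁ ∧ j₁ ≤ j' ∧ C j₁ c = 1 := by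
      rcases hfirst with rfl | ⟨j₁, h₁, h₂, h₃⟩
      · exact ⟨j', hij.trans_lt hjj', le_rfl, hj'p⟩
      · exact ⟨j₁, h₁, h₂.trans hjj'.le, h₃⟩
    rcases hap'.lt_or_eq with hlt | rfl
    · refine ih p' hp'p j' (hij.trans hjj'.le) hlt (hp'p.le.trans hpc) hj'p'
        (fun s _ hsp' => hj'0 s hsp'.ne (hsp'.trans hp'p)) (fun r s h₁ h₂ h₃ h₄ => ?_)
        (Or.inr hfirst')
      rcases h₂.lt_or_eq with h | rfl
      · exact hbefore r s h₁ h h₃ (h₄.trans hp'p)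
      · exact hj'0 s h₄.ne (h₄.trans hp'p)
    by_cases hl : ∃ l, i < l ∧ l ≤ j' ∧ A l a = 1
    swap
    · push Not at hl
      obtain ⟨j₁, h₁, h₂, h₃⟩ := hfirst'
      exact Or.inr ⟨j₁, h₁, h₃, fun l hil hla =>
        h₂.trans_lt (not_le.mp fun hle => hl l hil hle hla)⟩
    obtain ⟨l, hil, hlj', hla⟩ := hl
    have hcolA : ∀ z, z ≠ i → z ≠ l → A z a = 0 := fun z =>
      eq_zero_of_sum_le_two (f := fun x => A x a)
        ((hA.2.2 a).le.trans (hd a)) hP.left_A hla hil.ne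
    have hbelow : ∃ x : Fin m, j' < x ∧ ∃ q₀, a ≤ q₀ ∧ q₀ < p ∧ C x q₀ = 1 := by
      by_contra! hcon
      have hC1 : ∑ x, C x a ≤ ∑ x, unitMatrix j' a x a := by
        refine sum_le_sum fun x _ => ?_
        rcases lt_trichotomy x j' with hx | rfl | hx
        · refine le_of_eq_of_le ?_ (Nat.zero_le _)
          rcases lt_trichotomy x i with hxi | rfl | hxi
          · rw [← hP.above x hxi]
            exact hcolA x hxi.ne (hxi.trans hil).ne
          · exact hP.left_C
          · exact hbefore x a hxi hx le_rfl hap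
        · simp [unitMatrix, hj'p']
        · exact ((hC.1 x a).resolve_right (hcon x hx a le_rfl hap)).le.trans (Nat.zero_le _)
      have hA2 : ∑ x ∈ ({i, l} : Finset (Fin m)), A x a ≤ ∑ x, A x a :=
        sum_le_univ_sum_of_nonneg fun x => Nat.zero_le _
      rw [sum_pair hil.ne, hP.left_A, hla, hA.2.2 a, ← hC.2.2 a] at hA2
      have : ∑ x, unitMatrix j' a x a = 1 := by simp [unitMatrix]
      omega
    obtain ⟨x, ⟨hj'x, q₀, haq₀, hq₀p, hxq₀⟩, hmin⟩ := WellFounded.has_min wellFounded_lt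
      {x : Fin m | j' < x ∧ ∃ q₀, a ≤ q₀ ∧ q₀ < p ∧ C x q₀ = 1} hbelow
    refine Or.inl ⟨j, x, q₀, p, hjj'.trans hj'x, hq₀p, hj0 q₀ haq₀ hq₀p, hjp, hxq₀,
      col_eq_zero p hjp hj'p hjj'.ne (hjj'.trans hj'x).ne' hj'x.ne', ?_⟩
    intro y q hy₁ hy₂ hq₁ hq₂
    have hiy : (i : ℕ) < y := lt_of_le_of_lt hij hy₁
    have haq : (a : ℕ) < q := lt_of_le_of_lt haq₀ hq₁
    have hqc : q ≤ c := hq₂.trans hpc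
    by_cases hyj' : y ≤ j'
    · exact hP.boxSum_lt_of_zero hAC hiy haq hqc fun r s h₁ h₂ h₃ h₄ =>
        hbefore r s h₁ (h₂.trans_le hyj') h₃ (h₄.trans_le hq₂)
    · refine hP.boxSum_lt hAC hiy haq hqc (le_trans ?_ (one_le_boxSum hla hil
        (lt_of_le_of_lt hlj' (not_le.mp hyj')) le_rfl haq))
      refine boxSum_le_one hC.1 (r₀ := j') (s₀ := a) fun r s h₁ h₂ h₃ h₄ h1 => ?_
      have hsp : s < p := h₄.trans_le hq₂
      rcases lt_trichotomy r j' with hr | rfl | hr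
      · rw [hbefore r s h₁ hr h₃ hsp] at h1
        exact absurd h1 (by norm_num)
      · refine ⟨rfl, ?_⟩
        by_contra hs
        rw [hj'0 s hs hsp] at h1
        exact absurd h1 (by norm_num)
      · exact absurd (h₂.trans_le hy₂) (hmin r ⟨hr, s, h₃, hsp, h1⟩)
  refine stair c i le_rfl hP.lt le_rfl hP.right_C (fun s has hsc => ?_)
    (fun r s h₁ h₂ => absurd h₁ h₂.not_gt) (Or.inl rfl)
  rcases has.lt_or_eq with h | rfl
  · exact hrow s h hsc
  · exact hP.left_C

/-- If row `i` has a common one strictly between the columns of the pivot, then `C` has an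
interchange above `A`. -/
theorem IsPivot.hasInterchangeAbove_of_between {r : Fin m → ℕ} {d : Fin n → ℕ}
    (hP : IsPivot A C i a c) (hA : isBCT r d A) (hC : isBCT r d C) (hAC : bruhatLE A C)
    (hr : ∀ i, r i ≤ 2) (hd : ∀ j, d j ≤ 2) {x : Fin n} (hax : a < x) (hxc : x < c)
    (hix : C i x = 1) : HasInterchangeAbove A C := by
  have row_eq_zero : ∀ (j : Fin m) {x y z : Fin n}, C j x = 1 → C j y = 1 → x ≠ y →
      z ≠ x → z ≠ y → C j z = 0 := fun j _ _ _ =>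
    eq_zero_of_sum_le_two ((hC.2.1 j).le.trans (hr j))
  have col_eq_zero : ∀ (s : Fin n) {x y z : Fin m}, C x s = 1 → C y s = 1 → x ≠ y →
      z ≠ x → z ≠ y → C z s = 0 := fun s _ _ _ =>
    eq_zero_of_sum_le_two (f := fun x => C x s) ((hC.2.2 s).le.trans (hd s))
  have hi0 : ∀ s, s ≠ x → s < c → C i s = 0 := fun s hsx hsc =>
    row_eq_zero i hix hP.right_C hxc.ne hsx hsc.ne
  obtain ⟨u, p₀, hiu, hap₀, hp₀x, hup₀, hbeforeu, hcase⟩ :=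
    hP.exists_next hA hC hAC le_rfl hax hxc.le hix fun r s h₁ h₂ => absurd h₁ h₂.not_gt
  rcases hcase with h | hux | h
  · rw [hi0 p₀ hp₀x.ne (hp₀x.trans hxc)] at h
    exact absurd h (by norm_num)
  swap
  · exact h
  have stair : ∀ (p : Fin n) (j : Fin m), i ≤ j → j < u → x < p → p ≤ c → C j p = 1 →
      (∀ r s, i < r → r ≤ j → a ≤ s → s < p → C r s = 0) → HasInterchangeAbove A C := by
    intro p
    induction p using WellFoundedLT.induction with
    | ind p ih =>
    intro j hij hju hxp hpc hjp hzero
    have hj0 : ∀ s, a ≤ s → s ≠ x → s < p → C j s = 0 := by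
      intro s has hsx hsp
      rcases hij.lt_or_eq with h | rfl
      · exact hzero j s h le_rfl has hsp
      · exact hi0 s hsx (hsp.trans_le hpc)
    obtain ⟨j', p', hjj', hap', hp'p, hj'p', hbefore, hcase⟩ :=
      hP.exists_next hA hC hAC hij (hax.trans hxp) hpc hjp hzero
    have hj'u : j' ≤ u := by
      by_contra hcon
      rw [hbefore u p₀ hiu (not_le.mp hcon) hap₀ (hp₀x.trans hxp)] at hup₀
      exact absurd hup₀ (by norm_num)
    rcases hj'u.lt_or_eq with hlt | rfl
    · have hp'x : p' ≠ x := by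
        rintro rfl
        rw [col_eq_zero p' hix hux hiu.ne (hij.trans_lt hjj').ne' hlt.ne] at hj'p'
        exact absurd hj'p' (by norm_num)
      have hxp' : x < p' := by
        refine lt_of_le_of_ne (not_lt.mp fun hcon => ?_) hp'x.symm
        rw [hbeforeu j' p' (hij.trans_lt hjj') hlt hap' hcon] at hj'p'
        exact absurd hj'p' (by norm_num)
      rcases hcase with h | hj'p | h
      · rw [hj0 p' hap' hp'x hp'p] at h
        exact absurd h (by norm_num)
      · refine ih p' hp'p j' (hij.trans hjj'.le) hlt hxp' (hp'p.le.trans hpc) hj'p'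
          fun r s h₁ h₂ h₃ h₄ => ?_
        rcases h₂.lt_or_eq with h | rfl
        · exact hbefore r s h₁ h h₃ (h₄.trans hp'p)
        · exact row_eq_zero r hj'p' hj'p hp'p.ne h₄.ne (h₄.trans hp'p).ne
      · exact h
    · refine ⟨j, j', p₀, p, hju, hp₀x.trans hxp, hj0 p₀ hap₀ hp₀x.ne (hp₀x.trans hxp), hjp, hup₀,
        row_eq_zero j' hup₀ hux hp₀x.ne (hp₀x.trans hxp).ne' hxp.ne', ?_⟩
      intro y q hy₁ hy₂ hq₁ hq₂
      exact hP.boxSum_lt_of_zero hAC (lt_of_le_of_lt hij hy₁) (lt_of_le_of_lt hap₀ hq₁)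
        (hq₂.trans hpc) fun r s h₁ h₂ h₃ h₄ =>
          hbefore r s h₁ (h₂.trans_le hy₂) h₃ (h₄.trans_le hq₂)
  exact stair c i le_rfl hiu hxc le_rfl hP.right_C fun r s h₁ h₂ => absurd h₁ h₂.not_gt

/-- Two distinct comparable matrices with the same margins have a pivot. -/
theorem exists_isPivot {r : Fin m → ℕ} {d : Fin n → ℕ} (hA : isBCT r d A) (hC : isBCT r d C)
    (hAC : bruhatLE A C) (hne : A ≠ C) : ∃ i a c, IsPivot A C i a c := by
  obtain ⟨i, hi, hmin⟩ := WellFounded.has_min wellFounded_lt {i : Fin m | A i ≠ C i}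
    (Function.ne_iff.mp hne)
  have habove : ∀ r < i, A r = C r := fun r hr => by_contra fun h => hmin r h hr
  have hC_col : ∃ c, A i c < C i c := by
    by_contra! hcon
    refine hi (funext fun s => ?_)
    have hsum : ∑ s, C i s = ∑ s, A i s := by rw [hA.2.1, hC.2.1]
    exact ((sum_eq_sum_iff_of_le fun s _ => hcon s).mp hsum s (mem_univ s)).symm
  obtain ⟨c, hc, hcmin⟩ := WellFounded.has_min wellFounded_lt {c : Fin n | A i c < C i c} hC_col
  have hA_col : ∃ a, a < c ∧ C i a < A i a := by
    by_contra! hcon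
    rw [bruhatLE_iff_boxSum] at hAC
    have h1 := hAC (i + 1) (c + 1)
    have h2 : boxSum A 0 (i + 1) 0 (c + 1) + boxSum (unitMatrix i c) 0 (i + 1) 0 (c + 1)
        ≤ boxSum C 0 (i + 1) 0 (c + 1) := by
      rw [← boxSum_add]
      refine boxSum_mono fun r s _ hr _ hs => ?_
      unfold unitMatrix
      rcases (show r ≤ i from Nat.lt_succ_iff.mp hr).lt_or_eq with hlt | rfl
      · rw [if_neg fun h => hlt.ne h.1, habove r hlt, add_zero]
      · rcases (show s ≤ c from Nat.lt_succ_iff.mp hs).lt_or_eq with hlt | rfl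
        · rw [if_neg fun h => hlt.ne h.2, add_zero]
          exact hcon s hlt
        · rw [if_pos ⟨rfl, rfl⟩]
          exact hc
    rw [boxSum_unitMatrix, if_pos (by omega)] at h2
    omega
  obtain ⟨a, ⟨hac, ha⟩, hamax⟩ := WellFounded.has_min wellFounded_gt
    {a : Fin n | a < c ∧ C i a < A i a} hA_col
  have hc' : A i c < C i c := hc
  have h01 := hA.1 i
  have h01' := hC.1 i
  refine ⟨i, a, c, fun r hr s => by rw [habove r hr], hac, ?_, ?_, ?_, ?_, fun s has hsc => ?_⟩
  · have := h01 a; have := h01' a; omega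
  · have := h01 a; have := h01' a; omega
  · have := h01 c; have := h01' c; omega
  · have := h01 c; have := h01' c; omega
  · exact le_antisymm (not_lt.mp fun h => hamax s ⟨hsc, h⟩ has)
      (not_lt.mp fun h => hcmin s h hsc)

theorem IsPivot.colRev (hP : IsPivot A C i a c) :
    IsPivot (colRev C) (colRev A) i c.rev a.rev where
  above r hr s := (hP.above r hr s.rev).symm
  lt := Fin.rev_lt_rev.mpr hP.lt
  left_A := by simp [_root_.colRev, hP.right_C]
  left_C := by simp [_root_.colRev, hP.right_A]
  right_A := by simp [_root_.colRev, hP.left_C]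
  right_C := by simp [_root_.colRev, hP.left_A]
  between s hs₁ hs₂ := (hP.between s.rev (Fin.lt_rev_iff.mpr hs₂) (Fin.rev_lt_iff.mpr hs₁)).symm

theorem hasInterchangeAbove_or_colRev {r : Fin m → ℕ} {d : Fin n → ℕ} (hA : isBCT r d A)
    (hC : isBCT r d C) (hAC : bruhatLE A C) (hr : ∀ i, r i ≤ 2) (hd : ∀ j, d j ≤ 2)
    (hne : A ≠ C) : HasInterchangeAbove A C ∨ HasInterchangeAbove (colRev C) (colRev A) := by
  obtain ⟨i, a, c, hP⟩ := exists_isPivot hA hC hAC hne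
  by_cases hx : ∃ x, a < x ∧ x < c ∧ C i x = 1
  · obtain ⟨x, hax, hxc, hix⟩ := hx
    exact Or.inl (hP.hasInterchangeAbove_of_between hA hC hAC hr hd hax hxc hix)
  push Not at hx
  have hrow : ∀ s, a < s → s < c → C i s = 0 := fun s h₁ h₂ =>
    (hC.1 i s).resolve_right (hx s h₁ h₂)
  rcases hP.hasInterchangeAbove_or hA hC hAC hr hd hrow with h | ⟨j₁, hij₁, hj₁, hfirst⟩
  · exact Or.inl h
  rcases hP.colRev.hasInterchangeAbove_or (isBCT_colRev hC) (isBCT_colRev hA)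
    (bruhatLE_colRev hA hC hAC) hr (fun j => hd j.rev)
    (fun s h₁ h₂ => (hP.between s.rev (Fin.lt_rev_iff.mpr h₂) (Fin.rev_lt_iff.mpr h₁)).trans
      (hrow s.rev (Fin.lt_rev_iff.mpr h₂) (Fin.rev_lt_iff.mpr h₁)))
    with h | ⟨l₁, hil₁, hl₁, hfirst'⟩
  · exact Or.inr h
  · simp only [colRev, Fin.rev_rev] at hl₁ hfirst'
    exact absurd (hfirst l₁ hil₁ hl₁) (hfirst' j₁ hij₁ hj₁).not_gt

/-- On a class all of whose row and column sums are at most two, the Bruhat order is contained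
in the secondary Bruhat order. -/
theorem secBLE_of_bruhatLE {r : Fin m → ℕ} {d : Fin n → ℕ} (hA : isBCT r d A)
    (hC : isBCT r d C) (hAC : bruhatLE A C) (hr : ∀ i, r i ≤ 2) (hd : ∀ j, d j ≤ 2) :
    secBLE A C := by
  obtain ⟨N, hN⟩ : ∃ N, ∑ i, ∑ j, sigmaM A i j = ∑ i, ∑ j, sigmaM C i j + N :=
    Nat.exists_eq_add_of_le (sum_le_sum fun i _ => sum_le_sum fun j _ => hAC i j)
  induction N using Nat.strong_induction_on generalizing A C with
  | _ N ih =>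
  by_cases hne : A = C
  · exact hne ▸ Relation.ReflTransGen.refl
  have sum_lt : ∀ M M' : Fin m → Fin n → ℕ, bruhatLE M' M → M' ≠ M →
      ∑ i, ∑ j, sigmaM M i j < ∑ i, ∑ j, sigmaM M' i j := by
    intro M M' hle hMM'
    obtain ⟨i, j, hij⟩ : ∃ i j, sigmaM M i j < sigmaM M' i j := by
      by_contra! hcon
      have hle' : bruhatLE M M' := fun i j => hcon i j
      rw [bruhatLE_iff_boxSum] at hle hle'
      exact hMM' (eq_of_boxSum_eq fun y q => le_antisymm (hle y q) (hle' y q))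
    exact sum_lt_sum (fun i _ => sum_le_sum fun j _ => hle i j)
      ⟨i, mem_univ i, sum_lt_sum (fun j _ => hle i j) ⟨j, mem_univ j, hij⟩⟩
  have sum_le : ∀ M M' : Fin m → Fin n → ℕ, bruhatLE M' M →
      ∑ i, ∑ j, sigmaM M i j ≤ ∑ i, ∑ j, sigmaM M' i j :=
    fun M M' hle => sum_le_sum fun i _ => sum_le_sum fun j _ => hle i j
  rcases hasInterchangeAbove_or_colRev hA hC hAC hr hd hne with h | h
  · obtain ⟨C', hstep, hAC'⟩ := h.exists_step hAC
    have h1 := sum_lt C C' hstep.bruhatLE hstep.ne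
    have h2 := sum_le C' A hAC'
    exact Relation.ReflTransGen.head hstep
      (ih (∑ i, ∑ j, sigmaM A i j - ∑ i, ∑ j, sigmaM C' i j) (by omega) hA
        (isBCT_of_interchangeStep hC hstep) hAC' (by omega))
  · obtain ⟨B, hstep, hCB⟩ := h.exists_step (bruhatLE_colRev hA hC hAC)
    have hB := isBCT_of_interchangeStep (isBCT_colRev hA) hstep
    have hA'C := bruhatLE_colRev (isBCT_colRev hC) hB hCB
    have hstep' := interchangeStep_colRev hstep
    have hB' := isBCT_colRev hB
    rw [colRev_colRev] at hA'C hstep'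
    simp only [Fin.rev_rev] at hB'
    have h1 := sum_lt (colRev B) A hstep'.bruhatLE hstep'.ne
    have h2 := sum_le C (colRev B) hA'C
    exact Relation.ReflTransGen.tail
      (ih (∑ i, ∑ j, sigmaM (colRev B) i j - ∑ i, ∑ j, sigmaM C i j) (by omega) hB' hC hA'C
        (by omega)) hstep'

end LineSums

/-! ### A pattern on which the orders differ -/

section Counterexample

theorem Nat.card_filter_mod_eq {m : ℕ} (hm : 0 < m) (N : ℕ) (j : Fin m) :
    #{u ∈ range N | u % m = j} = N / m + if (j : ℕ) < N % m then 1 else 0 := by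
  have h := Nat.count_modEq_card N hm (j : ℕ)
  rw [Nat.count_eq_card_filter_range, Nat.mod_eq_of_lt j.isLt] at h
  simpa only [Nat.ModEq, Nat.mod_eq_of_lt j.isLt] using h

/-- A 0-1 matrix with prescribed row sums and column sums as equal as possible: the rows are
consecutive cyclic intervals. -/
theorem exists_balanced_matrix {m : ℕ} (hm : 0 < m) {p : ℕ} (R : Fin p → ℕ) (hR : ∀ i, R i ≤ m) :
    ∃ X : Fin p → Fin m → ℕ, (∀ i j, X i j = 0 ∨ X i j = 1) ∧ (∀ i, ∑ j, X i j = R i) ∧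
      ∀ j : Fin m, ∑ i, X i j = #{u ∈ range (∑ i, R i) | u % m = j} := by
  induction p with
  | zero => exact ⟨fun _ _ => 0, by simp, fun i => i.elim0, by simp⟩
  | succ p ih =>
    obtain ⟨X, h01, hrow, hcol⟩ := ih (fun i => R i.castSucc) fun i => hR _
    set T := ∑ i : Fin p, R i.castSucc with hT
    let v : Fin m → ℕ := fun j => #{u ∈ Ico T (T + R (Fin.last p)) | u % m = j}
    refine ⟨Fin.snoc (α := fun _ => Fin m → ℕ) X v, fun i j => ?_, fun i => ?_, fun j => ?_⟩
    · refine Fin.lastCases ?_ (fun i => ?_) i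
      · rw [Fin.snoc_last]
        have hle : v j ≤ 1 := by
          refine card_le_one.mpr fun a ha b hb => ?_
          rw [mem_filter, mem_Ico] at ha hb
          have hlen := hR (Fin.last p)
          have key : ∀ x y : ℕ, x ≤ y → x % m = y % m → y < x + m → x = y := by
            intro x y hxy hmod hlt
            have hdvd := (Nat.modEq_iff_dvd' hxy).mp hmod
            have := Nat.eq_zero_of_dvd_of_lt hdvd (by omega)
            omega
          rcases le_total a b with hab | hab
          · exact key a b hab (ha.2.trans hb.2.symm) (by omega)
          · exact (key b a hab (hb.2.trans ha.2.symm) (by omega)).symm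
        omega
      · rw [Fin.snoc_castSucc]
        exact h01 i j
    · refine Fin.lastCases ?_ (fun i => ?_) i
      · rw [Fin.snoc_last, Fin.sum_univ_eq_sum_range
          (fun j => #{u ∈ Ico T (T + R (Fin.last p)) | u % m = j}) m,
          ← card_eq_sum_card_fiberwise fun u _ => by simpa using Nat.mod_lt u hm]
        simp
      · rw [Fin.snoc_castSucc]
        exact hrow i
    · rw [Fin.sum_univ_castSucc, Fin.sum_univ_castSucc]
      simp only [Fin.snoc_castSucc, Fin.snoc_last]
      rw [hcol j, ← hT, range_eq_Ico, range_eq_Ico,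
        ← Ico_union_Ico_eq_Ico (Nat.zero_le T) (Nat.le_add_right T _), filter_union,
        card_union_of_disjoint (disjoint_filter_filter (Ico_disjoint_Ico_consecutive _ _ _))]

/-- A `4 × 4` pattern in which the entries `1 0 / 0 1` in the middle block every partial
interchange. -/
def blockingPattern : Fin 4 → Fin 4 → ℕ :=
  ![![0, 0, 0, 1], ![1, 1, 0, 1], ![1, 0, 1, 1], ![1, 0, 0, 0]]

theorem exists_bruhatLE_not_secBLE {n : ℕ} {r c : Fin n → ℕ} (hn : 4 ≤ n) {C : Fin n → Fin n → ℕ}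
    (hC : isBCT r c C)
    (hpat : ∀ a b : Fin 4, C (a.castLE hn) (b.castLE hn) = blockingPattern a b) :
    ∃ A, isBCT r c A ∧ bruhatLE A C ∧ ¬ secBLE A C := by
  have hlt : ∀ {a b : Fin 4}, a < b → a.castLE hn < b.castLE hn := fun h => h
  obtain ⟨B, hCB, hB, hboxB⟩ := exists_interchangeStep (C := C)
    (hlt (show (0 : Fin 4) < 3 by decide)) (hlt (show (0 : Fin 4) < 3 by decide))
    (hpat 0 0) (hpat 0 3) (hpat 3 0) (hpat 3 3)
  have hpatB : ∀ a b : Fin 4, a = 1 ∨ a = 2 →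
      B (a.castLE hn) (b.castLE hn) = blockingPattern a b := by
    intro a b ha
    rw [hB, ← hpat]
    simp only [Fin.castLE_inj]
    rcases ha with rfl | rfl <;> simp
  obtain ⟨A, hAB, hboxA⟩ := exists_interchangeStep_to (B := B)
    (hlt (show (1 : Fin 4) < 2 by decide)) (hlt (show (1 : Fin 4) < 2 by decide))
    (hpatB 1 1 (.inl rfl)) (hpatB 1 2 (.inl rfl)) (hpatB 2 1 (.inr rfl)) (hpatB 2 2 (.inr rfl))
  have hbox : ∀ y q, boxSum A 0 y 0 q + (if y = 2 ∧ q = 2 then 1 else 0)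
      = boxSum C 0 y 0 q + if 1 ≤ y ∧ y ≤ 3 ∧ 1 ≤ q ∧ q ≤ 3 then 1 else 0 := by
    intro y q
    have h₁ := hboxA y q
    have h₂ := hboxB y q
    simp only [Fin.val_castLE, Fin.val_zero, Fin.val_one, Fin.val_two,
      show ((3 : Fin 4) : ℕ) = 3 from rfl] at h₁ h₂
    split_ifs at h₁ h₂ ⊢ <;> omega
  refine ⟨A, isBCT_of_interchangeStep_to (isBCT_of_interchangeStep hC hCB) hAB, ?_, fun hsec => ?_⟩
  · rw [bruhatLE_iff_boxSum]
    intro y q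
    have h := hbox y q
    split_ifs at h <;> omega
  · rcases Relation.ReflTransGen.cases_head hsec with rfl | ⟨C', hstep, hrest⟩
    · simpa using hbox 1 1
    · obtain ⟨i, j, k, l, hij, hkl, h₁, h₂, h₃, h₄, h₁', h₂', h₃', h₄', hoff⟩ := hstep
      have hC' := boxSum_of_add_unitMatrix hij hkl
        (InterchangeStep.add_unitMatrix hij hkl h₁ h₂ h₃ h₄ h₁' h₂' h₃' h₄' hoff)
      have hAC' := bruhatLE_iff_boxSum.mp (bruhatLE_of_secBLE hrest)
      have key : ∀ y q : ℕ, (i : ℕ) < y → y ≤ j → (k : ℕ) < q → q ≤ l →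
          y ≤ 3 ∧ q ≤ 3 ∧ ¬(y = 2 ∧ q = 2) := by
        intro y q hy hy' hq hq'
        have e₁ := hC' y q
        have e₂ := hAC' y q
        have e₃ := hbox y q
        rw [if_pos ⟨hy, hy', hq, hq'⟩] at e₁
        split_ifs at e₃ <;> omega
      obtain ⟨hj, hl, -⟩ := key j l hij le_rfl hkl le_rfl
      have hmid : ¬((i : ℕ) < 2 ∧ 2 ≤ (j : ℕ) ∧ (k : ℕ) < 2 ∧ 2 ≤ (l : ℕ)) :=
        fun h => (key 2 2 h.1 h.2.1 h.2.2.1 h.2.2.2).2.2 ⟨rfl, rfl⟩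
      have hlift : ∀ x : Fin n, (x : ℕ) ≤ 3 → ∃ a : Fin 4, a.castLE hn = x :=
        fun x hx => ⟨⟨x, by omega⟩, rfl⟩
      obtain ⟨a, rfl⟩ := hlift i (by omega)
      obtain ⟨b, rfl⟩ := hlift j hj
      obtain ⟨d, rfl⟩ := hlift k (by omega)
      obtain ⟨e, rfl⟩ := hlift l hl
      rw [hpat] at h₁ h₂ h₃ h₄
      have hnone : ∀ a b d e : Fin 4, a < b → d < e →
          ¬((a : ℕ) < 2 ∧ 2 ≤ (b : ℕ) ∧ (d : ℕ) < 2 ∧ 2 ≤ (e : ℕ)) →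
          blockingPattern a d = 0 → blockingPattern a e = 1 → blockingPattern b d = 1 →
          blockingPattern b e ≠ 0 := by
        decide
      exact hnone a b d e hij hkl hmid h₁ h₂ h₃ h₄

/-- For `3 ≤ k ≤ n - 3` the blocking pattern extends to a matrix with all margins equal to `k`. -/
theorem exists_isBCT_blockingPattern {m k : ℕ} (hk : 3 ≤ k) (hkm : k ≤ m + 1) :
    ∃ C : Fin (4 + m) → Fin (4 + m) → ℕ, isBCT (fun _ => k) (fun _ => k) C ∧
      ∀ a b : Fin 4, C (a.castAdd m) (b.castAdd m) = blockingPattern a b := by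
  have hm : 0 < m := by omega
  obtain ⟨Y, hY, hYrow, hYcol⟩ := exists_balanced_matrix hm ![k - 3, k - 1, k - 1, k - 3]
    (by intro i; fin_cases i <;> simp <;> omega)
  have hsum : ∑ i, ![k - 3, k - 1, k - 1, k - 3] i = 4 * k - 8 := by
    simp [Fin.sum_univ_four]
    omega
  have hf : ∀ j, ∑ i, Y i j ≤ k ∧ k ≤ m + ∑ i, Y i j := by
    intro j
    have hcard := hYcol j
    rw [hsum, Nat.card_filter_mod_eq hm] at hcard
    have hle : ∑ i, Y i j ≤ 4 := by
      calc ∑ i, Y i j ≤ ∑ _i : Fin 4, 1 := sum_le_sum fun i _ => by have := hY i j; omega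
        _ = 4 := by simp
    have hdiv := Nat.div_add_mod (4 * k - 8) m
    have hmod := Nat.mod_lt (4 * k - 8) hm
    constructor
    · by_contra hlt
      have hk3 : k = 3 := by omega
      subst hk3
      have h4 : 4 ≤ (4 * 3 - 8) / m + 1 := by split_ifs at hcard <;> omega
      have h3 : m * 3 ≤ m * ((4 * 3 - 8) / m) := Nat.mul_le_mul_left m (by omega)
      omega
    · by_contra hlt
      have hk1 : k = m + 1 := by omega
      have hS : ∑ i, Y i j = 0 := by omega
      have h0 : (4 * k - 8) / m = 0 := (Nat.add_eq_zero_iff.mp (hcard.symm.trans hS)).1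
      rw [h0] at hdiv
      omega
  set f : Fin m → ℕ := fun j => ∑ i, Y i j with hfdef
  have hfsum : ∑ j, f j = 4 * k - 8 := by
    rw [hfdef, sum_comm, ← hsum]
    exact sum_congr rfl fun i _ => hYrow i
  obtain ⟨X, hX, hXrow, hXcol⟩ := exists_balanced_matrix hm
    (Fin.addCases ![k - 1, k - 3, k - 3, k - 1] (fun j => k - f j) : Fin (4 + m) → ℕ) (by
      intro i
      refine Fin.addCases (fun i => ?_) (fun i => ?_) i
      · rw [Fin.addCases_left]
        fin_cases i <;> simp <;> omega
      · rw [Fin.addCases_right]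
        have := hf i
        simp only [hfdef]
        omega)
  have htot : ∑ j, (k - f j) + (4 * k - 8) = m * k := by
    rw [← hfsum, ← sum_add_distrib, sum_congr rfl fun j _ => Nat.sub_add_cancel (hf j).1]
    simp
  have hXsum : ∑ i, (Fin.addCases ![k - 1, k - 3, k - 3, k - 1] (fun j => k - f j) :
      Fin (4 + m) → ℕ) i = m * k := by
    rw [Fin.sum_univ_add]
    simp only [Fin.addCases_left, Fin.addCases_right]
    rw [← htot, Fin.sum_univ_four]
    simp
    omega
  have hXcol' : ∀ j, ∑ i, X i j = k := by
    intro j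
    rw [hXcol, hXsum, Nat.card_filter_mod_eq hm]
    simp [Nat.mul_div_cancel_left k hm]
  refine ⟨fun r s => Fin.addCases (fun b => Fin.addCases (fun a => blockingPattern a b)
    (fun r' => Y b r') r) (fun s' => X r s') s, ⟨fun r s => ?_, fun r => ?_, fun s => ?_⟩, ?_⟩
  · refine Fin.addCases (fun b => ?_) (fun s' => ?_) s
    · refine Fin.addCases (fun a => ?_) (fun r' => ?_) r
      · simp only [Fin.addCases_left]
        revert a b
        decide
      · simpa only [Fin.addCases_left, Fin.addCases_right] using hY b r'
    · simpa only [Fin.addCases_right] using hX r s'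
  · rw [Fin.sum_univ_add]
    simp only [Fin.addCases_left, Fin.addCases_right]
    rw [hXrow]
    refine Fin.addCases (fun a => ?_) (fun r' => ?_) r
    · simp only [Fin.addCases_left]
      fin_cases a <;> simp [Fin.sum_univ_four, blockingPattern] <;> omega
    · simp only [Fin.addCases_right]
      exact Nat.add_sub_of_le (hf r').1
  · refine Fin.addCases (fun b => ?_) (fun s' => ?_) s
    · rw [Fin.sum_univ_add]
      simp only [Fin.addCases_left, Fin.addCases_right]
      rw [hYrow]
      fin_cases b <;> simp [Fin.sum_univ_four, blockingPattern] <;> omega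
    · simpa only [Fin.addCases_right] using hXcol' s'
  · intro a b
    simp only [Fin.addCases_left]

end Counterexample

/-- The two combinatorial Bruhat orders coincide on `BCT(k^n, k^n)` if and only if
`n ≤ 5`, or `n ≥ 6` and `k ∈ {0, 1, 2, n-2, n-1, n}`. -/
theorem bruhat_orders_coincide_kn {n k : ℕ} (hk : k ≤ n) :
    (∀ M1 M2 : Fin n → Fin n → ℕ,
        isBCT (fun _ => k) (fun _ => k) M1 → isBCT (fun _ => k) (fun _ => k) M2 →
        (bruhatLE M1 M2 ↔ secBLE M1 M2))
    ↔ (n ≤ 5 ∨ (6 ≤ n ∧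
        (k = 0 ∨ k = 1 ∨ k = 2 ∨ k = n - 2 ∨ k = n - 1 ∨ k = n))) := by
  have hcompl : ∀ M : Fin n → Fin n → ℕ, isBCT (fun _ => k) (fun _ => k) M →
      isBCT (fun _ => n - k) (fun _ => n - k) (complMatrix M) := fun _ h => isBCT_complMatrix h
  constructor
  · intro h
    by_contra hcon
    obtain ⟨m, rfl⟩ : ∃ m, n = 4 + m := ⟨n - 4, by omega⟩
    obtain ⟨C, hC, hpat⟩ := exists_isBCT_blockingPattern (m := m) (k := k) (by omega) (by omega)
    obtain ⟨A, hA, hAC, hsec⟩ := exists_bruhatLE_not_secBLE (Nat.le_add_right 4 m) hC hpat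
    exact hsec ((h A C hA hC).mp hAC)
  · intro hcase A C hA hC
    refine ⟨fun hAC => ?_, bruhatLE_of_secBLE⟩
    by_cases hk2 : k ≤ 2
    · exact secBLE_of_bruhatLE hA hC hAC (fun _ => hk2) fun _ => hk2
    · have hnk : n - k ≤ 2 := by omega
      have h := secBLE_complMatrix (secBLE_of_bruhatLE (hcompl C hC) (hcompl A hA)
        (bruhatLE_complMatrix hA.1 hC.1 hAC) (fun _ => hnk) fun _ => hnk)
      rwa [complMatrix_complMatrix hA.1, complMatrix_complMatrix hC.1] at h
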